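/- arXiv:1809.02990 — 3 statements merged into one kernel-verified Lean document; each statement's English description precedes it below -/
import Mathlib

section
/- Let Λ ⊂ ℂ be a lattice (a discrete free ℤ-submodule of rank 2). Then the Weierstrass invariants g₂(Λ) = 60 G₄(Λ) and g₃(Λ) = 140 G₆(Λ), where G_k(Λ) = Σ_{0≠ω∈Λ} ω^{-k}, satisfy Δ := g₂(Λ)³ − 27 g₃(Λ)² ≠ 0. -/
/-- The Eisenstein series `G_k(Λ) = ∑_{0 ≠ ω ∈ Λ} ω⁻ᵏ` of a lattice `Λ ⊂ ℂ`. -/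
noncomputable def latticeEisenstein (Λ : AddSubgroup ℂ) (k : ℕ) : ℂ :=
  ∑' w : {x : ℂ // x ∈ Λ ∧ x ≠ 0}, ((w : ℂ) ^ k)⁻¹

/-- The Weierstrass invariant `g₂(Λ) = 60 G₄(Λ)`. -/
noncomputable def latticeG2 (Λ : AddSubgroup ℂ) : ℂ := 60 * latticeEisenstein Λ 4

/-- The Weierstrass invariant `g₃(Λ) = 140 G₆(Λ)`. -/
noncomputable def latticeG3 (Λ : AddSubgroup ℂ) : ℂ := 140 * latticeEisenstein Λ 6

lemma latticeEisenstein_eq_tsum (ω₁ ω₂ : ℂ) (hindep : LinearIndependent ℝ ![ω₁, ω₂])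
    (k : ℕ) (hk : k ≠ 0) :
    latticeEisenstein (AddSubgroup.closure {ω₁, ω₂}) k =
      ∑' v : Fin 2 → ℤ, (((v 0 : ℂ) * ω₁ + (v 1 : ℂ) * ω₂) ^ k)⁻¹ := by
  classical
  set Λ := AddSubgroup.closure ({ω₁, ω₂} : Set ℂ) with hΛ
  let F : ℂ → ℂ := fun x => if x ∈ Λ then (x ^ k)⁻¹ else 0
  let p : (Fin 2 → ℤ) → ℂ := fun v => (v 0 : ℂ) * ω₁ + (v 1 : ℂ) * ω₂
  have hmem : ∀ x, x ∈ Λ ↔ ∃ v, p v = x := by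
    intro x
    rw [hΛ, AddSubgroup.mem_closure_pair]
    constructor
    · rintro ⟨a, b, h⟩
      exact ⟨![a, b], by simpa [p] using h⟩
    · rintro ⟨v, h⟩
      exact ⟨v 0, v 1, by simpa [p] using h⟩
  have hinj : Function.Injective p := by
    intro v w h
    have := LinearIndependent.pair_iff.mp hindep (v 0 - w 0) (v 1 - w 1)
      (by simp only [p] at h; simp; linear_combination h)
    obtain ⟨h0, h1⟩ := this
    have h0' : v 0 = w 0 := by exact_mod_cast sub_eq_zero.mp h0
    have h1' : v 1 = w 1 := by exact_mod_cast sub_eq_zero.mp h1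
    ext i
    fin_cases i
    · exact h0'
    · exact h1'
  have e1 : latticeEisenstein Λ k = ∑' x, F x := by
    rw [latticeEisenstein, ← Function.Injective.tsum_eq
      (g := fun w : {x : ℂ // x ∈ Λ ∧ x ≠ 0} => (w : ℂ)) (f := F) Subtype.val_injective]
    · refine tsum_congr fun w => ?_
      simp [F, w.2.1]
    · intro x hx
      have hx' : F x ≠ 0 := hx
      by_cases hxm : x ∈ Λ
      · refine ⟨⟨x, hxm, ?_⟩, rfl⟩
        rintro rfl
        simp [F, hk] at hx'
      · simp [F, hxm] at hx'
  have e2 : ∑' v, ((p v) ^ k)⁻¹ = ∑' x, F x := by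
    rw [← Function.Injective.tsum_eq (f := F) hinj]
    · refine tsum_congr fun v => ?_
      have : p v ∈ Λ := (hmem _).2 ⟨v, rfl⟩
      simp [F, this]
    · intro x hx
      have hx' : F x ≠ 0 := hx
      by_cases hxm : x ∈ Λ
      · exact (hmem x).1 hxm
      · simp [F, hxm] at hx'
  rw [e1, ← e2]

open UpperHalfPlane in
lemma latticeEisenstein_eq_E (ω₁ ω₂ : ℂ) (hindep : LinearIndependent ℝ ![ω₁, ω₂])
    (τ : ℍ) (hτ : (τ : ℂ) * ω₂ = ω₁) (k : ℕ) (hk : 3 ≤ k) :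
    latticeEisenstein (AddSubgroup.closure {ω₁, ω₂}) k =
      (ω₂ ^ k)⁻¹ * (2 * riemannZeta k * ModularForm.E hk τ) := by
  rw [latticeEisenstein_eq_tsum ω₁ ω₂ hindep k (by omega)]
  have hE : ModularForm.E hk τ = (1 / 2 : ℂ) • eisensteinSeries (N := 1) 0 k τ := rfl
  have h := tsum_eisSummand_eq_riemannZeta_mul_eisensteinSeries hk τ
  have : 2 * riemannZeta k * ModularForm.E hk τ
      = ∑' v : Fin 2 → ℤ, EisensteinSeries.eisSummand k v τ := by
    rw [h, hE, smul_eq_mul]; ring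
  rw [this, ← tsum_mul_left]
  refine tsum_congr fun v => ?_
  rw [EisensteinSeries.eisSummand, zpow_neg, zpow_natCast, ← mul_inv, ← mul_pow, ← hτ]
  congr 2
  ring

lemma riemannZeta_six' : riemannZeta 6 = (Real.pi : ℂ) ^ 6 / 945 := by
  have h := riemannZeta_two_mul_nat (k := 3) (by norm_num)
  have hb : bernoulli 6 = 1 / 42 := by
    have h5 : bernoulli' 5 = 0 := by
      rw [bernoulli'_def]
      norm_num [Finset.sum_range_succ, Finset.sum_range_zero, Nat.choose, bernoulli'_three,
        bernoulli'_four]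
    rw [bernoulli_eq_bernoulli'_of_ne_one (by norm_num), bernoulli'_def]
    norm_num [Finset.sum_range_succ, Finset.sum_range_zero, Nat.choose, bernoulli'_three,
      bernoulli'_four, h5]
  norm_num [hb, Nat.factorial] at h
  rw [h]; ring

lemma weierstrass_disc_aux (ω₁ ω₂ : ℂ) (hindep : LinearIndependent ℝ ![ω₁, ω₂])
    (him : 0 < (ω₁ / ω₂).im) :
    latticeG2 (AddSubgroup.closure {ω₁, ω₂}) ^ 3 -
      27 * latticeG3 (AddSubgroup.closure {ω₁, ω₂}) ^ 2 ≠ 0 := by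
  have h2 : ω₂ ≠ 0 := by rintro rfl; simp at him
  let τ : UpperHalfPlane := ⟨ω₁ / ω₂, him⟩
  have hτ : (τ : ℂ) * ω₂ = ω₁ := div_mul_cancel₀ _ h2
  have hΔ := ModularForm.discriminant_ne_zero τ
  rw [ModularForm.discriminant_eq_E₄_cube_sub_E₆_sq] at hΔ
  have e4 := latticeEisenstein_eq_E ω₁ ω₂ hindep τ hτ 4 (by norm_num)
  have e6 := latticeEisenstein_eq_E ω₁ ω₂ hindep τ hτ 6 (by norm_num)
  have z4 : riemannZeta ((4 : ℕ) : ℂ) = (Real.pi : ℂ) ^ 4 / 90 := by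
    exact_mod_cast riemannZeta_four
  have z6 : riemannZeta ((6 : ℕ) : ℂ) = (Real.pi : ℂ) ^ 6 / 945 := by
    exact_mod_cast riemannZeta_six'
  rw [z4] at e4
  rw [z6] at e6
  have hpi : (Real.pi : ℂ) ≠ 0 := by exact_mod_cast Real.pi_ne_zero
  rw [latticeG2, latticeG3, e4, e6]
  have key : ∀ a b : ℂ,
      (60 * ((ω₂ ^ 4)⁻¹ * (2 * ((Real.pi : ℂ) ^ 4 / 90) * a))) ^ 3
        - 27 * (140 * ((ω₂ ^ 6)⁻¹ * (2 * ((Real.pi : ℂ) ^ 6 / 945) * b))) ^ 2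
      = 4096 * (Real.pi / ω₂) ^ 12 * ((a ^ 3 - b ^ 2) / 1728) := by
    intro a b
    field_simp
    ring
  rw [key]
  exact mul_ne_zero (mul_ne_zero (by norm_num) (pow_ne_zero _ (div_ne_zero hpi h2))) hΔ

/-- For a lattice `Λ = ℤω₁ + ℤω₂ ⊂ ℂ` (with `ω₁, ω₂` linearly independent over `ℝ`, so that
`Λ` is a discrete free `ℤ`-submodule of rank `2`), the Weierstrass invariants
`g₂(Λ) = 60 G₄(Λ)` and `g₃(Λ) = 140 G₆(Λ)` satisfy `Δ = g₂³ - 27 g₃² ≠ 0`. -/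
theorem weierstrass_discriminant_ne_zero (ω₁ ω₂ : ℂ)
    (hindep : LinearIndependent ℝ ![ω₁, ω₂]) :
    latticeG2 (AddSubgroup.closure {ω₁, ω₂}) ^ 3 -
      27 * latticeG3 (AddSubgroup.closure {ω₁, ω₂}) ^ 2 ≠ 0 := by
  have h2 : ω₂ ≠ 0 := hindep.ne_zero 1
  have him : (ω₁ / ω₂).im ≠ 0 := by
    intro h
    have hre : ω₁ = ((ω₁ / ω₂).re : ℂ) * ω₂ := by
      have : ((ω₁ / ω₂).re : ℂ) = ω₁ / ω₂ := Complex.ext (by simp) (by simp [h])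
      rw [this, div_mul_cancel₀ _ h2]
    have := LinearIndependent.pair_iff.mp hindep 1 (-(ω₁ / ω₂).re)
      (by simp only [Complex.real_smul]; push_cast; linear_combination hre)
    exact one_ne_zero this.1
  rcases lt_or_gt_of_ne him with h | h
  · rw [Set.pair_comm]
    refine weierstrass_disc_aux ω₂ ω₁ (LinearIndependent.pair_symm_iff.mp hindep) ?_
    rw [← inv_div, Complex.inv_im]
    refine div_pos (neg_pos.mpr h) (Complex.normSq_pos.mpr ?_)
    intro h0
    simp [h0] at h
  · exact weierstrass_disc_aux ω₁ ω₂ hindep h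
end

section
/- Let char(Q) = 0 and B a finite-dimensional semisimple Q-algebra. Every maximal étale Q-subalgebra of B has degree over Q equal to the reduced degree [B:Q]_red. -/
open Module

/-- A subalgebra `S` of a `Q`-algebra `B` is *étale* (for `char Q = 0` and `S` finite
dimensional) if it is commutative and reduced: such algebras are exactly the finite products
of finite (automatically separable) field extensions of `Q`. -/
def Subalgebra.IsEtaleSubalgebra {Q B : Type*} [Field Q] [Ring B] [Algebra Q B]
    (S : Subalgebra Q B) : Prop :=
  (∀ x y : S, x * y = y * x) ∧ IsReduced S


namespace MaxEtale

/-- The trace of left multiplication. -/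
noncomputable def tr (F B : Type*) [Field F] [Ring B] [Algebra F B] : B →ₗ[F] F :=
  (LinearMap.trace F B) ∘ₗ (Algebra.lmul F B).toLinearMap

lemma trace_idem {F B : Type*} [Field F] [CharZero F] [Ring B] [Algebra F B]
    [FiniteDimensional F B] (e : B) (he : e * e = e) (h : tr F B e = 0) : e = 0 := by
  have h1 : IsIdempotentElem (Algebra.lmul F B e) := by
    rw [IsIdempotentElem, ← map_mul, he]
  have h2 := LinearMap.IsIdempotentElem.eq_zero_of_trace_eq_zero h1 h
  have := congrArg (fun f => f 1) h2
  simpa using this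

lemma trace_mul_comm' {F B : Type*} [Field F] [Ring B] [Algebra F B] (x y : B) :
    tr F B (x * y) = tr F B (y * x) := by
  simp only [tr, LinearMap.comp_apply, AlgHom.toLinearMap_apply, map_mul]
  exact LinearMap.trace_mul_comm _ _ _

lemma trace_nilp {F B : Type*} [Field F] [Ring B] [Algebra F B] [FiniteDimensional F B]
    (x : B) (hx : IsNilpotent x) : tr F B x = 0 := by
  have h : IsNilpotent (Algebra.lmul F B x) := hx.map _
  exact (LinearMap.isNilpotent_trace_of_isNilpotent h).eq_zero

lemma exists_idem {R : Type*} [Ring R] [IsSemisimpleRing R] (x : R) (hx : x ≠ 0) :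
    ∃ e a : R, e * e = e ∧ e ≠ 0 ∧ e = a * x := by
  obtain ⟨e, he, hI⟩ := IsSemisimpleRing.ideal_eq_span_idempotent (Ideal.span {x})
  have h1 : e ∈ Ideal.span {x} := by rw [hI]; exact Ideal.subset_span rfl
  have h2 : x ∈ Ideal.span {e} := by rw [← hI]; exact Ideal.subset_span rfl
  obtain ⟨a, ha⟩ := Ideal.mem_span_singleton'.1 h1
  obtain ⟨b, hb⟩ := Ideal.mem_span_singleton'.1 h2
  refine ⟨e, a, he, ?_, ha.symm⟩
  rintro rfl
  simp at hb
  exact hx hb.symm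

/-- nondegeneracy of the trace of `B` on a semisimple `S` mapping injectively to `B`. -/
lemma trace_nondeg {F S B : Type*} [Field F] [CharZero F] [Ring B] [Algebra F B]
    [FiniteDimensional F B] [Ring S] [Algebra F S] [IsSemisimpleRing S] (φ : S →ₐ[F] B)
    (hφ : Function.Injective φ) (x : S) (h : ∀ s, tr F B (φ (s * x)) = 0) : x = 0 := by
  by_contra hx
  obtain ⟨e, a, he, he0, hea⟩ := exists_idem x hx
  have h1 := h a
  rw [← hea] at h1
  have := trace_idem (φ e) (by rw [← map_mul, he]) h1
  exact he0 (hφ (by simpa using this))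

lemma exists_casimir (F S : Type*) [Field F] [CharZero F] [CommRing S] [Algebra F S]
    [FiniteDimensional F S] [IsReduced S] :
    ∃ (n : ℕ) (a b : Fin n → S), (∀ u, ∑ i, Algebra.trace F S (u * b i) • a i = u) ∧
      (∀ u, ∑ i, Algebra.trace F S (u * a i) • b i = u) ∧ ∑ i, a i * b i = 1 := by
  have : IsArtinianRing S := .of_finite F S
  have : IsSemisimpleRing S := IsArtinianRing.isSemisimpleRing_of_isReduced S
  have nd : ∀ x : S, (∀ s, Algebra.trace F S (s * x) = 0) → x = 0 := fun x h =>
    trace_nondeg (AlgHom.id F S) Function.injective_id x h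
  have hs : (Algebra.traceForm F S).IsSymm := Algebra.traceForm_isSymm F
  have hB : (Algebra.traceForm F S).Nondegenerate := by
    refine ⟨fun x h => nd x fun s => ?_, fun x h => nd x fun s => h s⟩
    rw [mul_comm]; exact h s
  let a := Module.finBasis F S
  let b := LinearMap.BilinForm.dualBasis (Algebra.traceForm F S) hB a
  have h2 : ∀ u, ∑ i, Algebra.trace F S (u * a i) • b i = u := by
    intro u
    conv_rhs => rw [← b.sum_repr u]
    simp [b]
  have h1 : ∀ u i, a.repr u i = Algebra.trace F S (u * b i) := by
    intro u i
    conv_rhs => rw [← a.sum_repr u]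
    rw [Finset.sum_mul, map_sum]
    have : ∀ j, Algebra.trace F S (a j * b i) = if j = i then 1 else 0 := fun j =>
      LinearMap.BilinForm.apply_dualBasis_right hB hs a j i
    simp [this]
  refine ⟨_, a, b, ?_, h2, ?_⟩
  · intro u
    conv_rhs => rw [← a.sum_repr u]
    simp [h1]
  · rw [← sub_eq_zero]
    apply nd
    intro s
    rw [mul_sub, map_sub, mul_one, Finset.mul_sum, map_sum, sub_eq_zero]
    rw [Algebra.trace_eq_matrix_trace a s, Matrix.trace]
    apply Finset.sum_congr rfl
    intro i _
    rw [Matrix.diag_apply, Algebra.leftMulMatrix_eq_repr_mul, h1, mul_assoc]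

lemma casimir_inv {F S M : Type*} [Field F] [CommRing S] [Algebra F S] [AddCommGroup M] [Module F M]
    {n : ℕ} (a b : Fin n → S) (h1 : ∀ u, ∑ i, Algebra.trace F S (u * b i) • a i = u)
    (h2 : ∀ u, ∑ i, Algebra.trace F S (u * a i) • b i = u) (g : S →ₗ[F] S →ₗ[F] M) (s : S) :
    ∑ i, g (s * a i) (b i) = ∑ i, g (a i) (s * b i) := by
  calc ∑ i, g (s * a i) (b i) = ∑ i, ∑ j, Algebra.trace F S (s * a i * b j) • g (a j) (b i) := by
        refine Finset.sum_congr rfl fun i _ => ?_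
        conv_lhs => rw [← h1 (s * a i)]
        simp
    _ = ∑ j, ∑ i, Algebra.trace F S (s * b j * a i) • g (a j) (b i) := by
        rw [Finset.sum_comm]
        simp only [mul_right_comm]
    _ = _ := by
        refine Finset.sum_congr rfl fun j _ => ?_
        conv_rhs => rw [← h2 (s * b j)]
        simp

lemma formallyEtale (F S : Type*) [Field F] [CharZero F] [CommRing S] [Algebra F S]
    [FiniteDimensional F S] [IsReduced S] : Algebra.FormallyEtale F S := by
  have : IsArtinianRing S := .of_finite F S
  have (I : MaximalSpectrum S) : Algebra.FormallyEtale F (S ⧸ I.asIdeal) := by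
    let _ := Ideal.Quotient.field I.asIdeal
    exact Algebra.FormallyEtale.of_isSeparable F _
  exact .of_equiv ((IsArtinianRing.equivPi S).restrictScalars F).symm


/-- The bilinear map `(u, v) ↦ φ u * c * φ v`. -/
noncomputable def sandwich {F S B : Type*} [Field F] [Ring B] [Algebra F B] [CommRing S]
    [Algebra F S] (φ : S →ₐ[F] B) (c : B) : S →ₗ[F] S →ₗ[F] B :=
  LinearMap.mk₂ F (fun u v => φ u * c * φ v) (by intros; simp [add_mul]) (by intros; simp)
    (by intros; simp [mul_add]) (by intros; simp)

/-- The projection onto the centralizer. -/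
noncomputable def proj {F S B : Type*} [Field F] [Ring B] [Algebra F B] [CommRing S]
    [Algebra F S] (φ : S →ₐ[F] B) {n : ℕ} (a b : Fin n → S) : B →ₗ[F] B :=
  ∑ i, LinearMap.mulLeft F (φ (a i)) ∘ₗ LinearMap.mulRight F (φ (b i))

lemma proj_apply {F S B : Type*} [Field F] [Ring B] [Algebra F B] [CommRing S]
    [Algebra F S] (φ : S →ₐ[F] B) {n : ℕ} (a b : Fin n → S) (c : B) :
    proj φ a b c = ∑ i, φ (a i) * c * φ (b i) := by
  simp [proj, LinearMap.sum_apply, mul_assoc]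

lemma proj_commute {F S B : Type*} [Field F] [Ring B] [Algebra F B] [CommRing S]
    [Algebra F S] (φ : S →ₐ[F] B) {n : ℕ} (a b : Fin n → S)
    (h1 : ∀ u, ∑ i, Algebra.trace F S (u * b i) • a i = u)
    (h2 : ∀ u, ∑ i, Algebra.trace F S (u * a i) • b i = u) (c : B) (s : S) :
    Commute (φ s) (proj φ a b c) := by
  have := casimir_inv a b h1 h2 (sandwich φ c) s
  rw [Commute, SemiconjBy, proj_apply, Finset.mul_sum, Finset.sum_mul]
  simp only [sandwich, LinearMap.mk₂_apply, map_mul] at this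
  refine Eq.trans ?_ (this.trans ?_)
  · simp [mul_assoc]
  · refine Finset.sum_congr rfl fun i _ => ?_
    rw [← map_mul, mul_comm s, map_mul]
    simp [mul_assoc]

lemma tr_proj_mul {F S B : Type*} [Field F] [Ring B] [Algebra F B] [CommRing S]
    [Algebra F S] (φ : S →ₐ[F] B) {n : ℕ} (a b : Fin n → S) (h3 : ∑ i, a i * b i = 1)
    (x : B) (hx : ∀ s, Commute (φ s) x) (c : B) :
    tr F B (proj φ a b c * x) = tr F B (c * x) := by
  rw [proj_apply, Finset.sum_mul, map_sum]
  have : ∀ i, tr F B (φ (a i) * c * φ (b i) * x) = tr F B (c * (φ (a i * b i) * x)) := by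
    intro i
    rw [mul_assoc, mul_assoc, trace_mul_comm', (hx (b i)).eq, mul_comm (a i), (hx _).eq]
    simp only [mul_assoc, map_mul]
  simp only [this]
  rw [← map_sum, ← Finset.mul_sum, ← Finset.sum_mul, ← map_sum, h3]
  simp

lemma mem_of_commute {F S B : Type*} [Field F] [CharZero F] [Ring B] [Algebra F B]
    [FiniteDimensional F B] [IsSemisimpleRing B] [CommRing S] [Algebra F S]
    [FiniteDimensional F S] [IsReduced S] (φ : S →ₐ[F] B)
    (hφ : Function.Injective φ)
    (hJ : ∀ x : B, (∀ s, Commute (φ s) x) → ∃ s, IsNilpotent (x - φ s))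
    (x : B) (hx : ∀ s, Commute (φ s) x) : ∃ s, φ s = x := by
  have : IsArtinianRing S := .of_finite F S
  have : IsSemisimpleRing S := IsArtinianRing.isSemisimpleRing_of_isReduced S
  -- nilpotents of the centralizer
  have hN1 : ∀ n : B, (∀ s, Commute (φ s) n) → IsNilpotent n → ∀ s, tr F B (φ s * n) = 0 :=
    fun n hn hnil s => trace_nilp _ ((hn s).isNilpotent_mul_left hnil)
  have hN2 : ∀ n : B, (∀ s, Commute (φ s) n) → (∀ s, tr F B (φ s * n) = 0) → IsNilpotent n := by
    intro n hn h
    obtain ⟨s, hs⟩ := hJ n hn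
    have : s = 0 := by
      refine trace_nondeg φ hφ s fun t => ?_
      have h1 := hN1 (n - φ s) (fun t => (hn t).sub_right ((Commute.all t s).map φ)) hs t
      rw [mul_sub, map_sub, h t, zero_sub, neg_eq_zero, ← map_mul] at h1
      exact h1
    simpa [this] using hs
  have hN3 : ∀ n m : B, (∀ s, Commute (φ s) n) → (∀ s, Commute (φ s) m) →
      IsNilpotent n → IsNilpotent m → tr F B (n * m) = 0 := by
    intro n m hn hm hnn hmm
    have h1 : IsNilpotent (n + m) := by
      refine hN2 _ (fun s => (hn s).add_right (hm s)) fun s => ?_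
      rw [mul_add, map_add, hN1 n hn hnn, hN1 m hm hmm, add_zero]
    have h2 : ∀ z : B, IsNilpotent z → tr F B (z * z) = 0 := fun z hz =>
      trace_nilp _ ((Commute.refl z).isNilpotent_mul_left hz)
    have h3 := h2 _ h1
    rw [add_mul, mul_add, mul_add, map_add, map_add, map_add, h2 n hnn, h2 m hmm,
      trace_mul_comm' m n] at h3
    have h4 : (2 : F) * tr F B (n * m) = 0 := by linear_combination h3
    simpa using h4
  obtain ⟨s, hs⟩ := hJ x hx
  refine ⟨s, ?_⟩
  have hxs : ∀ t, Commute (φ t) (x - φ s) := fun t => (hx t).sub_right ((Commute.all t s).map φ)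
  rw [eq_comm, ← sub_eq_zero]
  obtain ⟨k, a, b, h1, h2, h3⟩ := exists_casimir F S
  refine trace_nondeg (AlgHom.id F B) Function.injective_id _ fun c => ?_
  change tr F B (c * _) = 0
  rw [← tr_proj_mul φ a b h3 _ hxs]
  obtain ⟨t, ht⟩ := hJ _ (proj_commute φ a b h1 h2 c)
  have := hN3 _ _ (fun t' => (proj_commute φ a b h1 h2 c t').sub_right
    ((Commute.all t' t).map φ)) hxs ht hs
  rw [sub_mul, map_sub, hN1 _ hxs hs, sub_zero] at this
  exact this

lemma jordan {F B : Type*} [Field F] [CharZero F] [Ring B] [Algebra F B]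
    [FiniteDimensional F B] (S : Subalgebra F B)
    (hc : ∀ x y : S, x * y = y * x) (hr : IsReduced S)
    (hmax : ∀ S' : Subalgebra F B, (∀ x y : S', x * y = y * x) → IsReduced S' → S ≤ S' → S' = S)
    (x : B) (hx : ∀ s : S, Commute (s : B) x) : ∃ s : S, IsNilpotent (x - s) := by
  let A := Algebra.adjoin F ((S : Set B) ∪ {x})
  have hxA : x ∈ A := Algebra.subset_adjoin (Or.inr rfl)
  have hSA : S ≤ A := fun s hs => Algebra.subset_adjoin (Or.inl hs)
  have hAc : IsMulCommutative A := Algebra.isMulCommutative_adjoin F (by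
    rintro u (hu | hu) v (hv | hv)
    · exact congrArg Subtype.val (hc ⟨u, hu⟩ ⟨v, hv⟩)
    · rw [Set.mem_singleton_iff.1 hv]; exact hx ⟨u, hu⟩
    · rw [Set.mem_singleton_iff.1 hu]; exact (hx ⟨v, hv⟩).symm
    · rw [Set.mem_singleton_iff.1 hu, Set.mem_singleton_iff.1 hv])
  let _ : CommRing A := { (inferInstance : Ring A) with mul_comm := hAc.is_comm.comm }
  let _ : CommRing S := { (inferInstance : Ring S) with mul_comm := hc }
  have : IsNoetherianRing A := IsNoetherianRing.of_finite F A
  have hN : IsNilpotent (nilradical A) := IsNoetherianRing.isNilpotent_nilradical A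
  have hred : IsReduced (A ⧸ nilradical A) :=
    (Ideal.isRadical_iff_quotient_reduced _).1 (Ideal.radical_isRadical _)
  have : Algebra.FormallyEtale F (A ⧸ nilradical A) := formallyEtale _ _
  have : Algebra.FormallyEtale F S := formallyEtale _ _
  let σ : (A ⧸ nilradical A) →ₐ[F] A :=
    Algebra.FormallySmooth.lift (nilradical A) hN (AlgHom.id F _)
  have hσ : ∀ y, Ideal.Quotient.mk (nilradical A) (σ y) = y := fun y =>
    Algebra.FormallySmooth.mk_lift (nilradical A) hN (AlgHom.id F _) y
  let i : S →ₐ[F] A := Subalgebra.inclusion hSA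
  have hi : i = (σ.comp (Ideal.Quotient.mkₐ F (nilradical A))).comp i := by
    apply Algebra.FormallyUnramified.ext (I := nilradical A) hN
    intro s
    exact (hσ _).symm
  let τ : (A ⧸ nilradical A) →ₐ[F] B := A.val.comp σ
  have hτ : Function.Injective τ :=
    Subtype.val_injective.comp (Function.LeftInverse.injective hσ)
  have hS' : τ.range = S := by
    apply hmax
    · rintro ⟨_, u, rfl⟩ ⟨_, v, rfl⟩
      apply Subtype.ext
      change τ u * τ v = τ v * τ u
      rw [← map_mul, mul_comm, map_mul]
    · exact isReduced_of_injective (AlgEquiv.ofInjective τ hτ).symm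
        (AlgEquiv.ofInjective τ hτ).symm.injective
    · intro s hs
      refine ⟨Ideal.Quotient.mk _ (i ⟨s, hs⟩), ?_⟩
      exact (congrArg Subtype.val (DFunLike.congr_fun hi ⟨s, hs⟩)).symm
  let y : A ⧸ nilradical A := Ideal.Quotient.mk _ ⟨x, hxA⟩
  refine ⟨⟨τ y, hS' ▸ ⟨y, rfl⟩⟩, ?_⟩
  have : (⟨x, hxA⟩ - σ y : A) ∈ nilradical A := by
    rw [← Ideal.Quotient.eq, hσ]
  have h := (mem_nilradical.1 this).map A.val
  rw [map_sub] at h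
  exact h

lemma tracial {F B : Type*} [Field F] [CharZero F] [Ring B] [Algebra F B]
    [FiniteDimensional F B] [IsSemisimpleRing B]
    (hcen : ∀ z : B, (∀ b, z * b = b * z) → ∃ c : F, algebraMap F B c = z)
    (l : B →ₗ[F] F) (hl : ∀ a b, l (a * b) = l (b * a)) : ∃ c : F, ∀ a, l a = c * tr F B a := by
  have nd : ∀ x : B, (∀ s, tr F B (s * x) = 0) → x = 0 := fun x h =>
    trace_nondeg (AlgHom.id F B) Function.injective_id x h
  let β : LinearMap.BilinForm F B := (LinearMap.mul F B).compr₂ (tr F B)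
  have hβ : ∀ x y, β x y = tr F B (x * y) := fun _ _ => rfl
  have hB : β.Nondegenerate := by
    refine ⟨fun x h => nd x fun s => ?_, fun x h => nd x fun s => h s⟩
    rw [trace_mul_comm']; exact h s
  let x := (β.toDual hB).symm l
  have hx : ∀ a, tr F B (x * a) = l a := fun a =>
    LinearMap.BilinForm.apply_toDual_symm_apply (hB := hB) l a
  obtain ⟨c, hc⟩ := hcen x (by
    intro b
    rw [← sub_eq_zero]
    apply nd
    intro s
    rw [trace_mul_comm', sub_mul, map_sub, mul_assoc, hx, mul_assoc, trace_mul_comm' b, mul_assoc,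
      hx, hl, sub_self])
  refine ⟨c, fun a => ?_⟩
  rw [← hx, ← hc, ← Algebra.smul_def, map_smul, smul_eq_mul]

lemma tr_one {F B : Type*} [Field F] [Ring B] [Algebra F B]
    [FiniteDimensional F B] : tr F B 1 = finrank F B := by
  rw [tr, LinearMap.comp_apply, AlgHom.toLinearMap_apply, map_one, LinearMap.trace_one]

lemma trace_left_right {F B : Type*} [Field F] [CharZero F] [Ring B] [Nontrivial B] [Algebra F B]
    [FiniteDimensional F B] [IsSemisimpleRing B]
    (hcen : ∀ z : B, (∀ b, z * b = b * z) → ∃ c : F, algebraMap F B c = z) (a b : B) :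
    finrank F B * LinearMap.trace F B (LinearMap.mulLeft F a ∘ₗ LinearMap.mulRight F b) =
      tr F B a * tr F B b := by
  have hd : (finrank F B : F) ≠ 0 := by
    exact_mod_cast (Module.finrank_pos (R := F) (M := B)).ne'
  have hR : ∀ b, LinearMap.trace F B (LinearMap.mulRight F b) = tr F B b := by
    let l : B →ₗ[F] F := LinearMap.trace F B ∘ₗ (LinearMap.mul F B).flip
    have hl : ∀ b, l b = LinearMap.trace F B (LinearMap.mulRight F b) := fun b => rfl
    obtain ⟨c, hc⟩ := tracial hcen l (by
      intro a b
      rw [hl, hl, LinearMap.mulRight_mul, LinearMap.mulRight_mul, LinearMap.trace_comp_comm'])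
    have h1 := hc 1
    rw [hl, tr_one, LinearMap.mulRight_one, LinearMap.trace_id] at h1
    have : c = 1 := by
      apply mul_right_cancel₀ hd
      rw [← h1, one_mul]
    intro b
    rw [← hl, hc, this, one_mul]
  let l : B →ₗ[F] F := LinearMap.trace F B ∘ₗ
    (LinearMap.lcomp F B (LinearMap.mulRight F b)) ∘ₗ (LinearMap.mul F B)
  have hl : ∀ a, l a = LinearMap.trace F B (LinearMap.mulLeft F a ∘ₗ LinearMap.mulRight F b) :=
    fun a => rfl
  obtain ⟨c, hc⟩ := tracial hcen l (by
    intro x y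
    have h : ∀ z, LinearMap.mulLeft F z ∘ₗ LinearMap.mulRight F b =
      LinearMap.mulRight F b ∘ₗ LinearMap.mulLeft F z := by
      intro z; ext; simp [mul_assoc]
    rw [hl, hl, LinearMap.mulLeft_mul, LinearMap.mulLeft_mul, LinearMap.comp_assoc, h y,
      ← LinearMap.comp_assoc, LinearMap.trace_comp_comm', LinearMap.comp_assoc])
  have h1 := hc 1
  rw [hl, LinearMap.mulLeft_one, LinearMap.id_comp, hR, tr_one] at h1
  rw [← hl, hc, h1]
  ring

lemma finrank_eq {F S B : Type*} [Field F] [CharZero F] [Ring B] [Nontrivial B] [Algebra F B]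
    [FiniteDimensional F B] [IsSemisimpleRing B]
    (hcen : ∀ z : B, (∀ b, z * b = b * z) → ∃ c : F, algebraMap F B c = z)
    [CommRing S] [Algebra F S]
    [FiniteDimensional F S] [IsReduced S] (φ : S →ₐ[F] B)
    (hφ : Function.Injective φ)
    (hC : ∀ x : B, (∀ s, Commute (φ s) x) → ∃ s, φ s = x) (d : ℕ) (hd : finrank F B = d ^ 2) :
    finrank F S = d := by
  have : IsArtinianRing S := .of_finite F S
  have : IsSemisimpleRing S := IsArtinianRing.isSemisimpleRing_of_isReduced S
  have nd : ∀ x : S, (∀ s, Algebra.trace F S (s * x) = 0) → x = 0 := fun x h =>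
    trace_nondeg (AlgHom.id F S) Function.injective_id x h
  have hd0 : (d : F) ≠ 0 := by
    have := (Module.finrank_pos (R := F) (M := B)).ne'
    rw [hd] at this
    exact_mod_cast (pow_ne_zero_iff two_ne_zero).1 this
  obtain ⟨k, a, b, h1, h2, h3⟩ := exists_casimir F S
  let w : S := ∑ i, tr F B (φ (b i)) • a i
  have hw : ∀ s, Algebra.trace F S (w * s) = tr F B (φ s) := by
    intro s
    conv_rhs => rw [← h2 s]
    simp only [w, Finset.sum_mul, map_sum, map_smul, smul_mul_assoc, smul_eq_mul]
    refine Finset.sum_congr rfl fun i _ => ?_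
    rw [mul_comm, mul_comm s]
  choose g hg using fun c => hC _ (proj_commute φ a b h1 h2 c)
  let G : B →ₗ[F] S :=
    { toFun := g
      map_add' := fun x y => hφ (by rw [map_add, hg, hg, hg, map_add])
      map_smul' := fun r x => hφ (by simp [hg]) }
  have hGφ : ∀ t, G (φ t) = t := by
    intro t
    apply hφ
    refine (hg _).trans ?_
    rw [proj_apply]
    simp only [← map_mul, ← map_sum]
    conv_rhs => rw [← one_mul t, ← h3, Finset.sum_mul]
    congr 1
    exact Finset.sum_congr rfl fun i _ => by ring
  have key : ∀ s, (d : F) ^ 2 * Algebra.trace F S s = Algebra.trace F S (s * (w * w)) := by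
    intro s
    let E : B →ₗ[F] S := LinearMap.mulLeft F s ∘ₗ G
    have e1 : E ∘ₗ φ.toLinearMap = LinearMap.mulLeft F s := by
      ext t; simp [E, hGφ]
    have e2 : φ.toLinearMap ∘ₗ E = ∑ i, LinearMap.mulLeft F (φ (s * a i)) ∘ₗ
        LinearMap.mulRight F (φ (b i)) := by
      ext c
      have : φ (G c) = _ := (hg c).trans (proj_apply _ _ _ _)
      simp [E, this, Finset.mul_sum, LinearMap.sum_apply, mul_assoc]
    have e3 : Algebra.trace F S s = LinearMap.trace F S (LinearMap.mulLeft F s) := rfl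
    rw [e3, ← e1, LinearMap.trace_comp_comm', e2, map_sum, Finset.mul_sum]
    have e4 := fun i => trace_left_right hcen (φ (s * a i)) (φ (b i))
    simp only [hd, Nat.cast_pow] at e4
    simp only [e4]
    rw [mul_left_comm, hw]
    simp only [w, Finset.mul_sum, map_sum, mul_smul_comm, map_smul, smul_eq_mul]
    exact Finset.sum_congr rfl fun i _ => mul_comm _ _
  have hw2 : w * w = algebraMap F S ((d : F) ^ 2) := by
    rw [eq_comm, ← sub_eq_zero]
    apply nd
    intro s
    rw [mul_sub, map_sub, ← key, mul_comm, ← Algebra.smul_def, map_smul, smul_eq_mul, sub_self]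
  have hwd : w = algebraMap F S d := by
    by_contra hne
    obtain ⟨e, c, he, he0, hec⟩ := exists_idem _ (sub_ne_zero.2 hne)
    have hwe : w * e = - (d : F) • e := by
      rw [Algebra.smul_def, map_neg]
      rw [map_pow] at hw2
      rw [hec]
      linear_combination c * hw2
    have h5 := hw e
    rw [hwe, map_smul, smul_eq_mul] at h5
    -- both traces are positive natural numbers
    have pos : ∀ (m : ℕ) (_ : m = 0 → False), (m : F) ≠ 0 := fun m hm => by
      exact_mod_cast hm
    have i1 : IsIdempotentElem (Algebra.lmul F S e) := by rw [IsIdempotentElem, ← map_mul, he]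
    have i2 : IsIdempotentElem (Algebra.lmul F B (φ e)) := by
      rw [IsIdempotentElem, ← map_mul, ← map_mul, he]
    have j1 := (LinearMap.IsIdempotentElem.isProj_range _ i1).trace
    have j2 := (LinearMap.IsIdempotentElem.isProj_range _ i2).trace
    change tr F B (φ e) = _ at j2
    change Algebra.trace F S e = _ at j1
    have k2 : tr F B (φ e) ≠ 0 := fun h => he0 (hφ (by
      rw [map_zero]; exact trace_idem _ (by rw [← map_mul, he]) h))
    rw [j1, j2] at h5
    rw [j2] at k2
    generalize finrank F (LinearMap.range (Algebra.lmul F S e)) = p at *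
    generalize finrank F (LinearMap.range (Algebra.lmul F B (φ e))) = q at *
    have h6 : ((d * p + q : ℕ) : F) = 0 := by push_cast; linear_combination -h5
    have h7 : d * p + q = 0 := by exact_mod_cast h6
    apply k2
    have : q = 0 := by omega
    simp [this]
  have h8 := hw 1
  rw [map_one, tr_one, mul_one, hwd, Algebra.trace_algebraMap, hd, nsmul_eq_mul] at h8
  have h9 : finrank F S * d = d ^ 2 := by exact_mod_cast h8
  have hd1 : d ≠ 0 := by exact_mod_cast hd0
  apply Nat.eq_of_mul_eq_mul_right (Nat.pos_of_ne_zero hd1)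
  rw [h9, sq]


section

/-- `B` as an algebra over its center. -/
@[reducible] noncomputable def centerAlgebra (Q B : Type*) [Field Q] [Ring B] [Algebra Q B] :
    Algebra (Subalgebra.center Q B) B where
  toSMul := inferInstance
  algebraMap := (Subalgebra.center Q B).val.toRingHom
  commutes' := fun z b => (Subalgebra.mem_center_iff.1 z.2 b).symm
  smul_def' := fun _ _ => rfl

attribute [local instance] centerAlgebra

lemma finrank_center {Q B : Type*} [Field Q] [CharZero Q] [Ring B] [IsSimpleRing B] [Algebra Q B]
    [FiniteDimensional Q B] (T : Subalgebra (Subalgebra.center Q B) B)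
    (hc : ∀ x y : T, x * y = y * x) (hr : IsReduced T)
    (hC : ∀ x : B, (∀ s : T, Commute (s : B) x) → x ∈ T) (d : ℕ)
    (hd : finrank (Subalgebra.center Q B) B = d ^ 2) :
    finrank (Subalgebra.center Q B) T = d := by
  have hf : IsField (Subalgebra.center Q B) := IsSimpleRing.isField_center B
  let _ : Field (Subalgebra.center Q B) := hf.toField
  have : CharZero (Subalgebra.center Q B) :=
    charZero_of_injective_algebraMap (algebraMap Q (Subalgebra.center Q B)).injective
  have : FiniteDimensional (Subalgebra.center Q B) B := Module.Finite.of_restrictScalars_finite Q _ _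
  have : IsArtinianRing B := .of_finite Q B
  let _ : CommRing T := { (inferInstance : Ring T) with mul_comm := hc }
  refine finrank_eq (F := Subalgebra.center Q B) (S := T) (B := B) ?_ T.val
    Subtype.val_injective ?_ d hd
  · intro z hz
    exact ⟨⟨z, Subalgebra.mem_center_iff.2 fun b => (hz b).symm⟩, rfl⟩
  · intro x hx
    exact ⟨⟨x, hC x hx⟩, rfl⟩

theorem aux
    (Q : Type*) [Field Q] [CharZero Q]
    (B : Type*) [Ring B] [Algebra Q B] [FiniteDimensional Q B]
    {ι : Type*} [Fintype ι]
    (Bi : ι → Type*) [∀ i, Ring (Bi i)] [∀ i, Algebra Q (Bi i)]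
    (iso : B ≃ₐ[Q] ((i : ι) → Bi i))
    (hsimple : ∀ i, IsSimpleRing (Bi i))
    (d : ι → ℕ)
    (hd : ∀ i, finrank (Subalgebra.center Q (Bi i)) (Bi i) = d i ^ 2)
    (S : Subalgebra Q B) (hS : S.IsEtaleSubalgebra)
    (hmax : ∀ S' : Subalgebra Q B, S'.IsEtaleSubalgebra → S ≤ S' → S' = S) :
    finrank Q S = ∑ i, d i * finrank Q (Subalgebra.center Q (Bi i)) := by
  classical
  have hfin : ∀ i, FiniteDimensional Q (Bi i) := fun i =>
    Module.Finite.of_surjective ((LinearMap.proj i).comp iso.toLinearMap)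
      ((Function.surjective_eval i).comp iso.surjective)
  have hart : ∀ i, IsArtinianRing (Bi i) := fun i => .of_finite Q (Bi i)
  have hBss : IsSemisimpleRing B := iso.symm.toRingEquiv.isSemisimpleRing
  -- `S` is its own centralizer
  have hCS : ∀ x : B, (∀ s ∈ S, Commute s x) → x ∈ S := by
    intro x hx
    let _ : CommRing S := { (inferInstance : Ring S) with mul_comm := hS.1 }
    have := hS.2
    obtain ⟨s, hs⟩ := MaxEtale.mem_of_commute (F := Q) (S := S) (B := B) S.val
      Subtype.val_injective (fun y hy => MaxEtale.jordan S hS.1 hS.2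
        (fun S' h1 h2 h3 => hmax S' ⟨h1, h2⟩ h3) y hy) x (fun s => hx s s.2)
    rw [← hs]
    exact s.2
  have hcomm : ∀ x ∈ S, ∀ y ∈ S, x * y = y * x := fun x hx y hy =>
    congrArg Subtype.val (hS.1 ⟨x, hx⟩ ⟨y, hy⟩)
  have hcen : ∀ i, ∀ z ∈ Subalgebra.center Q (Bi i), iso.symm (Pi.single i z) ∈ S := by
    intro i z hz
    apply hCS
    intro s _
    apply iso.injective
    rw [map_mul, map_mul, iso.apply_symm_apply]
    ext j
    by_cases h : j = i
    · subst h
      simpa using Subalgebra.mem_center_iff.1 hz _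
    · simp [h]
  have hmul : ∀ i (x y : Bi i), iso.symm (Pi.single i (x * y)) =
      iso.symm (Pi.single i x) * iso.symm (Pi.single i y) := by
    intro i x y
    rw [← map_mul, Pi.single_mul]
  let T : ∀ i, Subalgebra (Subalgebra.center Q (Bi i)) (Bi i) := fun i =>
    { carrier := {x | iso.symm (Pi.single i x) ∈ S}
      mul_mem' := fun {x y} hx hy => by
        simp only [Set.mem_ofPred_eq] at *
        rw [hmul]
        exact S.mul_mem hx hy
      add_mem' := fun {x y} hx hy => by
        simp only [Set.mem_ofPred_eq] at *
        rw [Pi.single_add, map_add]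
        exact S.add_mem hx hy
      algebraMap_mem' := fun z => hcen i _ z.2 }
  have hT : ∀ i x, x ∈ T i ↔ iso.symm (Pi.single i x) ∈ S := fun i x => Iff.rfl
  have hinj : ∀ i (x y : Bi i), iso.symm (Pi.single i x) = iso.symm (Pi.single i y) → x = y :=
    fun i x y h => Pi.single_injective i (iso.symm.injective h)
  have hST : ∀ s ∈ S, ∀ i, iso s i ∈ T i := by
    intro s hs i
    rw [hT]
    have : iso.symm (Pi.single i (iso s i)) = s * iso.symm (Pi.single i 1) := by
      apply iso.injective
      rw [map_mul, iso.apply_symm_apply, iso.apply_symm_apply]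
      ext j
      by_cases h : j = i
      · subst h; simp
      · simp [h]
    rw [this]
    exact S.mul_mem hs (hcen i 1 (one_mem _))
  have hTd : ∀ i, finrank (Subalgebra.center Q (Bi i)) (T i) = d i := by
    intro i
    have := hsimple i
    apply MaxEtale.finrank_center (T i) ?_ ?_ ?_ (d i) (hd i)
    · intro x y
      apply Subtype.ext
      apply hinj i
      change iso.symm (Pi.single i ((x : Bi i) * y)) = iso.symm (Pi.single i ((y : Bi i) * x))
      rw [hmul, hmul]
      exact hcomm _ x.2 _ y.2
    · constructor
      rintro ⟨x, hx⟩ ⟨n, hn⟩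
      have := hS.2
      have h0 : ∀ m : ℕ, (⟨_, hx⟩ : S) ^ (m + 1) = ⟨_, (T i).pow_mem hx (m + 1)⟩ := by
        intro m
        apply Subtype.ext
        change (iso.symm (Pi.single i x)) ^ (m + 1) = iso.symm (Pi.single i (x ^ (m + 1)))
        induction m with
        | zero => simp
        | succ m ih => rw [pow_succ, ih, ← hmul, ← pow_succ]
      have hn' : x ^ (n + 1) = 0 := by
        have : x ^ n = 0 := congrArg Subtype.val hn
        rw [pow_succ, this, zero_mul]
      have h1 : IsNilpotent (⟨_, hx⟩ : S) := ⟨n + 1, by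
        rw [h0]
        apply Subtype.ext
        change iso.symm (Pi.single i (x ^ (n + 1))) = 0
        rw [hn', Pi.single_zero, map_zero]⟩
      have h2 := congrArg Subtype.val h1.eq_zero
      apply Subtype.ext
      apply hinj i
      change iso.symm (Pi.single i x) = iso.symm (Pi.single i 0)
      rw [Pi.single_zero, map_zero]
      exact h2
    · intro x hx
      rw [hT]
      apply hCS
      intro s hs
      apply iso.injective
      rw [map_mul, map_mul, iso.apply_symm_apply]
      ext j
      by_cases h : j = i
      · subst h
        simpa using (hx ⟨_, hST s hs j⟩).eq
      · simp [h]
  let e : S ≃ₗ[Q] (∀ i, T i) :=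
    { toFun := fun s i => ⟨iso s i, hST s s.2 i⟩
      map_add' := fun x y => by ext i; simp
      map_smul' := fun r x => by ext i; simp
      invFun := fun f => ⟨iso.symm (fun i => (f i : Bi i)), by
        rw [← Finset.univ_sum_single (fun i => (f i : Bi i)), map_sum]
        exact S.sum_mem fun i _ => (f i).2⟩
      left_inv := fun s => by ext; simp
      right_inv := fun f => by ext i; simp }
  have hTf : ∀ i, Module.Finite Q (T i) := fun i =>
    Module.Finite.of_injective ((T i).val.toLinearMap.restrictScalars Q) Subtype.val_injective
  rw [e.finrank_eq, Module.finrank_pi_fintype]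
  refine Finset.sum_congr rfl fun i _ => ?_
  have hf : IsField (Subalgebra.center Q (Bi i)) :=
    have := hsimple i
    IsSimpleRing.isField_center (Bi i)
  let _ : Field (Subalgebra.center Q (Bi i)) := hf.toField
  rw [← hTd i, mul_comm]
  exact (Module.finrank_mul_finrank Q (Subalgebra.center Q (Bi i)) (T i)).symm


end

end MaxEtale

/-- **Maximal étale subalgebras have the reduced degree.**  Let `Q` be a field of
characteristic `0` and `B` a finite-dimensional semisimple `Q`-algebra, given with its
decomposition `B ≅ Π i, B i` into simple `Q`-algebras with centers `F i` and
`[B i : F i] = (d i)²`, so that `[B : Q]_red = ∑ i, d i · [F i : Q]`.  Then every maximal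
étale `Q`-subalgebra `S` of `B` satisfies `[S : Q] = [B : Q]_red`. -/
theorem maximal_etale_subalgebra_finrank_eq_reduced_degree
    (Q : Type*) [Field Q] [CharZero Q]
    (B : Type*) [Ring B] [Algebra Q B] [FiniteDimensional Q B]
    {ι : Type*} [Fintype ι]
    (Bi : ι → Type*) [∀ i, Ring (Bi i)] [∀ i, Algebra Q (Bi i)]
    (iso : B ≃ₐ[Q] ((i : ι) → Bi i))
    (hsimple : ∀ i, IsSimpleRing (Bi i))
    (d : ι → ℕ)
    (hd : ∀ i, finrank (Subalgebra.center Q (Bi i)) (Bi i) = d i ^ 2)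
    (S : Subalgebra Q B) (hS : S.IsEtaleSubalgebra)
    (hmax : ∀ S' : Subalgebra Q B, S'.IsEtaleSubalgebra → S ≤ S' → S' = S) :
    finrank Q S = ∑ i, d i * finrank Q (Subalgebra.center Q (Bi i)) := by
  exact MaxEtale.aux Q B Bi iso hsimple d hd S hS hmax
end

section
/- Let X be a simple abelian variety over ℂ with complex multiplication, i.e. 2·dim X = [End(X)⊗ℚ : ℚ]_red. Then E = End(X)⊗ℚ is a CM-field of degree 2·dim X over ℚ (a totally imaginary quadratic extension of a totally real field). -/
open Module

open NumberField in
lemma cm_aux_approx {K : Type*} [Field K] [NumberField K]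
    (F : ((K →+* ℂ) → ℂ) → ℝ) (hF : Continuous F) (h : ∀ x : K, 0 ≤ F (fun τ => τ x))
    (y : InfinitePlace K → K) : 0 ≤ F (fun τ => τ (y (InfinitePlace.mk τ))) := by
  let T : ((v : InfinitePlace K) → WithAbs v.1) → ((K →+* ℂ) → ℂ) :=
    fun z τ => τ (z (InfinitePlace.mk τ)).ofAbs
  have hT : Continuous T := by
    refine continuous_pi fun τ => ?_
    have hi : Isometry (fun z : WithAbs (InfinitePlace.mk τ).1 => τ z.ofAbs) := by
      refine Isometry.of_dist_eq fun a b => ?_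
      rw [dist_eq_norm, dist_eq_norm, ← map_sub]
      rfl
    exact hi.continuous.comp (continuous_apply _)
  have hd := InfinitePlace.denseRange_algebraMap_pi K
  have hc : IsClosed {z | 0 ≤ F (T z)} := isClosed_le continuous_const (hF.comp hT)
  exact hd.induction_on (p := fun z => 0 ≤ F (T z))
    (fun v => WithAbs.toAbs v.1 (y v)) hc (fun x => h x)

open NumberField in
lemma cm_aux_not_real {K : Type*} [Field K] [NumberField K]
    (h : ∀ x : K, 0 ≤ (∏ τ : K →+* ℂ, τ x).re) (ρ : K →+* ℂ) :
    ∃ x, starRingEnd ℂ (ρ x) ≠ ρ x := by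
  classical
  by_contra! hr
  have hr' : ComplexEmbedding.conjugate ρ = ρ := RingHom.ext fun x => hr x
  have := cm_aux_approx (K := K) (fun z => (∏ τ, z τ).re) (by fun_prop) h
    (fun v => if v = InfinitePlace.mk ρ then -1 else 1)
  have h2 : ∀ τ : K →+* ℂ, τ (if InfinitePlace.mk τ = InfinitePlace.mk ρ then -1 else 1)
      = if τ = ρ then -1 else 1 := by
    intro τ
    have : InfinitePlace.mk τ = InfinitePlace.mk ρ ↔ τ = ρ := by
      rw [eq_comm, InfinitePlace.mk_eq_iff, hr', or_self, eq_comm]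
    simp only [this]
    split_ifs <;> simp
  simp only [h2] at this
  rw [Finset.prod_ite_eq' Finset.univ ρ (fun _ => (-1 : ℂ))] at this
  norm_num at this

open NumberField in
lemma cm_aux_conj {K : Type*} [Field K] [NumberField K] (σ : K →+* K)
    (hσ : ∀ x, σ (σ x) = x)
    (h : ∀ x : K, 0 ≤ (∑ τ : K →+* ℂ, τ x * τ (σ x)).re) (ρ : K →+* ℂ) (x : K) :
    ρ (σ x) = starRingEnd ℂ (ρ x) := by
  classical
  have key := cm_aux_approx (K := K) (fun z => (∑ τ, z τ * z (τ.comp σ)).re) (by fun_prop) h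
  beta_reduce at key
  have hconj : ∀ φ : K →+* ℂ, (ComplexEmbedding.conjugate φ).comp σ =
    ComplexEmbedding.conjugate (φ.comp σ) := fun φ => rfl
  have hss : ∀ φ : K →+* ℂ, (φ.comp σ).comp σ = φ := fun φ => by ext x; simp [hσ]
  have hmk : ∀ φ : K →+* ℂ, InfinitePlace.mk φ = InfinitePlace.mk ρ →
      InfinitePlace.mk (φ.comp σ) = InfinitePlace.mk (ρ.comp σ) := by
    intro φ hφ
    rcases InfinitePlace.mk_eq_iff.1 hφ with rfl | h
    · rfl
    · rw [← h, hconj, InfinitePlace.mk_conjugate_eq]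
  have hmk2 : ∀ φ : K →+* ℂ, InfinitePlace.mk φ = InfinitePlace.mk (ρ.comp σ) →
      InfinitePlace.mk (φ.comp σ) = InfinitePlace.mk ρ := by
    intro φ hφ
    rcases InfinitePlace.mk_eq_iff.1 hφ.symm with h | h
    · rw [← h, hss]
    · rw [← h, hconj, InfinitePlace.mk_conjugate_eq, hss]
  by_cases hw : InfinitePlace.mk ρ = InfinitePlace.mk (ρ.comp σ)
  · rcases InfinitePlace.mk_eq_iff.1 hw with h1 | h1
    · by_contra hx
      have h1x : ∀ x, ρ (σ x) = ρ x := fun x => (congrArg (fun f : K →+* ℂ => f x) h1).symm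
      have him : (ρ x).im ≠ 0 := by
        intro h0
        apply hx
        rw [h1x, eq_comm, Complex.conj_eq_iff_im]
        exact h0
      obtain ⟨q, hq1, hq2⟩ := exists_rat_btwn
        (show (ρ x).re - |(ρ x).im| < (ρ x).re + |(ρ x).im| by
          have := abs_pos.2 him; linarith)
      have ha : (ρ (x - q) * ρ (x - q)).re < 0 := by
        have : ((ρ x).re - q) ^ 2 < (ρ x).im ^ 2 := by
          rw [sq_lt_sq, abs_lt]; constructor <;> linarith
        simp [Complex.mul_re]
        nlinarith
      refine absurd (key (fun v => if v = InfinitePlace.mk ρ then x - q else 0)) (not_le.2 ?_)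
      have hterm : ∀ φ : K →+* ℂ, InfinitePlace.mk φ = InfinitePlace.mk ρ → φ.comp σ = φ := by
        intro φ hφ
        rcases InfinitePlace.mk_eq_iff.1 hφ.symm with h | h
        · rw [← h, ← h1]
        · rw [← h, hconj, ← h1]
      rw [Complex.re_sum]
      refine Finset.sum_neg' (fun φ _ => ?_) ⟨ρ, Finset.mem_univ _, ?_⟩
      · by_cases hφ : InfinitePlace.mk φ = InfinitePlace.mk ρ
        · rw [hterm φ hφ, if_pos hφ]
          rcases InfinitePlace.mk_eq_iff.1 hφ.symm with h | h
          · rw [← h]; exact ha.le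
          · rw [← h, ComplexEmbedding.conjugate_coe_eq, ← map_mul, Complex.conj_re]; exact ha.le
        · rw [if_neg hφ]; simp
      · rw [hterm ρ rfl, if_pos rfl]; exact ha
    · exact (congrArg (fun f : K →+* ℂ => f x) h1).symm
  · exfalso
    refine absurd (key (fun v => if v = InfinitePlace.mk ρ then 1 else
      if v = InfinitePlace.mk (ρ.comp σ) then -1 else 0)) (not_le.2 ?_)
    rw [Complex.re_sum]
    refine Finset.sum_neg' (fun φ _ => ?_) ⟨ρ, Finset.mem_univ _, ?_⟩
    · by_cases h1 : InfinitePlace.mk φ = InfinitePlace.mk ρ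
      · rw [hmk φ h1, if_pos h1, if_neg (Ne.symm hw), if_pos rfl]
        simp
      · by_cases h2 : InfinitePlace.mk φ = InfinitePlace.mk (ρ.comp σ)
        · rw [hmk2 φ h2, if_neg h1, if_pos h2, if_pos rfl]
          simp
        · rw [if_neg h1, if_neg h2]; simp
    · rw [if_pos rfl, if_neg (Ne.symm hw), if_pos rfl]
      simp

/-- Number field version. -/
lemma cm_aux_main {K : Type*} [Field K] [NumberField K] (σ : K →+* K)
    (hσ : ∀ x, σ (σ x) = x)
    (hpos : ∀ x : K, x ≠ 0 → 0 < Algebra.trace ℚ K (x * σ x))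
    (hnorm : ∀ x : K, 0 ≤ Algebra.norm ℚ x) :
    (∃ x, σ x ≠ x) ∧ ∀ (ρ : K →+* ℂ) (x : K), ρ (σ x) = starRingEnd ℂ (ρ x) := by
  have hc : ∀ (ρ : K →+* ℂ) (x : K), ρ (σ x) = starRingEnd ℂ (ρ x) := by
    refine cm_aux_conj σ hσ fun x => ?_
    have h1 : ∑ τ : K →+* ℂ, τ x * τ (σ x) = algebraMap ℚ ℂ (Algebra.trace ℚ K (x * σ x)) := by
      rw [trace_eq_sum_embeddings ℂ]
      exact Fintype.sum_equiv (RingHom.equivRatAlgHom K ℂ) _ _ (fun τ => by simp)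
    rw [h1]
    have h2 : 0 ≤ Algebra.trace ℚ K (x * σ x) := by
      by_cases hx : x = 0
      · simp [hx]
      · exact (hpos x hx).le
    simpa using h2
  refine ⟨?_, hc⟩
  obtain ⟨ρ⟩ : Nonempty (K →+* ℂ) := inferInstance
  obtain ⟨x, hx⟩ := cm_aux_not_real (K := K) (fun x => by
    have h1 : ∏ τ : K →+* ℂ, τ x = algebraMap ℚ ℂ (Algebra.norm ℚ x) := by
      rw [Algebra.norm_eq_prod_embeddings ℚ ℂ]
      exact Fintype.prod_equiv (RingHom.equivRatAlgHom K ℂ) _ _ (fun τ => by simp)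
    rw [h1]
    simpa using hnorm x) ρ
  refine ⟨x, fun h => hx ?_⟩
  rw [← hc, h]

lemma cm_aux_main' {K : Type*} [Field K] [inst : Algebra ℚ K] [FiniteDimensional ℚ K]
    (σ : K →+* K) (hσ : ∀ x, σ (σ x) = x)
    (hpos : ∀ x : K, x ≠ 0 → 0 < LinearMap.trace ℚ K (Algebra.lmul ℚ K (x * σ x)))
    (hnorm : ∀ x : K, 0 ≤ LinearMap.det (Algebra.lmul ℚ K x)) :
    (∃ x, σ x ≠ x) ∧ ∀ (ρ : K →+* ℂ) (x : K), ρ (σ x) = starRingEnd ℂ (ρ x) := by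
  have : CharZero K := algebraRat.charZero K
  obtain rfl : inst = DivisionRing.toRatAlgebra := Subsingleton.elim _ _
  have : NumberField K := { }
  exact cm_aux_main σ hσ hpos hnorm

lemma cm_aux_comm (E : Type*) [DivisionRing E] [Algebra ℚ E] [FiniteDimensional ℚ E]
    (g : ℕ) (hg : 0 < g) (e : ℕ)
    (he : finrank (Subalgebra.center ℚ E) E = e ^ 2)
    (hred : e * finrank ℚ (Subalgebra.center ℚ E) = 2 * g)
    (V : Type*) [AddCommGroup V] [Module ℚ V]
    [Module E V] [IsScalarTower ℚ E V]
    (hdim : finrank ℚ V = 2 * g) :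
    (∀ x y : E, x * y = y * x) ∧ finrank ℚ E = 2 * g ∧ finrank E V = 1 := by
  have hF : IsField (Subalgebra.center ℚ E) :=
    isField_of_isIntegral_of_isField' (Field.toIsField ℚ)
  have hfree : Module.Free (Subalgebra.center ℚ E) E := by
    letI := hF.toField
    exact Module.Free.of_divisionRing _ _
  have hfree2 : Module.Free ℚ (Subalgebra.center ℚ E) := Module.Free.of_divisionRing _ _
  have h1 : finrank ℚ (Subalgebra.center ℚ E) * finrank (Subalgebra.center ℚ E) E = finrank ℚ E :=
    Module.finrank_mul_finrank _ _ _
  have h2 : finrank ℚ E * finrank E V = finrank ℚ V := Module.finrank_mul_finrank _ _ _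
  rw [← h1, he, hdim, ← hred] at h2
  have hpos : 0 < e * finrank ℚ (Subalgebra.center ℚ E) := by rw [hred]; omega
  have h3 : e * finrank E V = 1 := by
    apply Nat.eq_of_mul_eq_mul_left hpos
    rw [mul_one]
    rw [← h2]; ring_nf; nlinarith
  obtain ⟨rfl, h4⟩ := mul_eq_one.1 h3
  refine ⟨?_, by rw [← h1, he, ← hred]; ring, h4⟩
  have h5 : ∀ w : E, ∃ c : Subalgebra.center ℚ E, c • (1 : E) = w :=
    by
    let := hF.toField
    rw [one_pow] at he
    exact (finrank_eq_one_iff_of_nonzero' (K := Subalgebra.center ℚ E) (1 : E) one_ne_zero).1 he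
  intro x y
  obtain ⟨⟨c, hc⟩, rfl⟩ := h5 x
  have := Subalgebra.mem_center_iff.1 hc y
  simpa [Subalgebra.smul_def] using this.symm

/-- **CM endomorphism algebras of simple abelian varieties are CM-fields.**
Let `X` be a simple abelian variety over `ℂ` of dimension `g > 0` with complex multiplication,
i.e. `2 dim X = [End(X) ⊗ ℚ : ℚ]_red`.  We model `E = End(X) ⊗ ℚ` as a finite-dimensional
division `ℚ`-algebra with `[E : F] = e²` for its center `F` and reduced degree
`e·[F : ℚ] = 2g`, acting faithfully on the homology `V = H₁(X, ℚ)` of dimension `2g`, with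
`deg α = det(α | V) ≥ 0` for all `α ∈ E`, and equipped with a Rosati involution `σ`: a
`ℚ`-linear anti-automorphism of order `2` which is *positive*, i.e. the trace of `α·σ(α)`
acting on `V` is positive for `α ≠ 0`.  Then `E` is a CM-field of degree `2g` over `ℚ`:
`E` is commutative, and there is a complex conjugation `c : E ≃ E`, `c ≠ id`, `c² = id`,
satisfying `ρ ∘ c = conj ∘ ρ` for every embedding `ρ : E → ℂ`
(equivalently, `E` is a totally imaginary quadratic extension of a totally real field). -/
theorem cm_endomorphism_algebra_is_CM_field
    (E : Type*) [DivisionRing E] [Algebra ℚ E] [FiniteDimensional ℚ E]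
    (g : ℕ) (hg : 0 < g) (e : ℕ)
    (he : finrank (Subalgebra.center ℚ E) E = e ^ 2)
    (hred : e * finrank ℚ (Subalgebra.center ℚ E) = 2 * g)
    (V : Type*) [AddCommGroup V] [Module ℚ V] [FiniteDimensional ℚ V]
    [Module E V] [IsScalarTower ℚ E V] [SMulCommClass E ℚ V] [FaithfulSMul E V]
    (hdim : finrank ℚ V = 2 * g)
    (hdet : ∀ α : E, 0 ≤ LinearMap.det (DistribMulAction.toLinearMap ℚ V α))
    (σ : E → E)
    (hσadd : ∀ x y, σ (x + y) = σ x + σ y)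
    (hσmul : ∀ x y, σ (x * y) = σ y * σ x)
    (hσinv : ∀ x, σ (σ x) = x)
    (hσℚ : ∀ q : ℚ, σ (algebraMap ℚ E q) = algebraMap ℚ E q)
    (hσpos : ∀ α : E, α ≠ 0 →
      0 < LinearMap.trace ℚ V (DistribMulAction.toLinearMap ℚ V (α * σ α))) :
    (∀ x y : E, x * y = y * x) ∧ finrank ℚ E = 2 * g ∧
      ∃ c : E →+* E, Function.Bijective c ∧ (∃ x, c x ≠ x) ∧ (∀ x, c (c x) = x) ∧
        ∀ (ρ : E →+* ℂ) (x : E), ρ (c x) = starRingEnd ℂ (ρ x) := by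
  obtain ⟨hcomm, hE, hV⟩ := cm_aux_comm E g hg e he hred V hdim
  refine ⟨hcomm, hE, ?_⟩
  obtain ⟨v, hv, -⟩ := finrank_eq_one_iff'.1 hV
  have hsp := (finrank_eq_one_iff_of_nonzero' v hv).1 hV
  let f : E ≃ₗ[ℚ] V := LinearEquiv.ofBijective
    ((LinearMap.toSpanSingleton E V v).restrictScalars ℚ)
    ⟨smul_left_injective E hv, hsp⟩
  have hfx : ∀ x : E, f x = x • v := fun x => rfl
  have hconj : ∀ α : E, DistribMulAction.toLinearMap ℚ V α =
      f.conj (Algebra.lmul ℚ E α) := by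
    intro α
    ext w
    obtain ⟨x, rfl⟩ := f.surjective w
    rw [LinearEquiv.conj_apply_apply, LinearEquiv.symm_apply_apply, hfx, hfx]
    exact (mul_smul α x v).symm
  simp only [hconj, LinearMap.trace_conj'] at hσpos
  have hdet' : ∀ α : E, 0 ≤ LinearMap.det (Algebra.lmul ℚ E α) := by
    intro α
    have := hdet α
    rwa [hconj, LinearEquiv.conj_apply, LinearMap.comp_assoc, LinearMap.det_conj] at this
  clear hdet hconj
  letI : Field E := { ‹DivisionRing E› with mul_comm := hcomm }
  have hσ1 : σ 1 = 1 := by simpa using hσℚ 1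
  have hσ0 : σ 0 = 0 := by simpa using hσℚ 0
  let c : E →+* E :=
    { toFun := σ, map_one' := hσ1, map_zero' := hσ0, map_add' := hσadd,
      map_mul' := fun x y => by rw [hσmul, hcomm] }
  obtain ⟨h1, h2⟩ := cm_aux_main' (K := E) c hσinv hσpos hdet'
  exact ⟨c, Function.Involutive.bijective hσinv, h1, hσinv, h2⟩
end
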